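/- arXiv:1111.7010 — 2 statements merged into one kernel-verified Lean document; each statement's English description precedes it below -/
import Mathlib

section
/- The function α ↦ c_f(α) is infinitely differentiable on the open interval (0,∞). -/
open MeasureTheory Real Filter Finset

/-- The Mellin-type kernel `W_k(x)`, written as the contour integral along `Re s = 5/4`. -/
noncomputable def Wk (k : ℕ) (x : ℝ) : ℂ :=
  (1 / (2 * Real.pi)) * ∫ t : ℝ,
    Complex.Gamma ((k : ℂ) + 1/4 + t * Complex.I) *
      Complex.Gamma (3/4 + t * Complex.I) *
      (Complex.Gamma (3/4 - t * Complex.I))⁻¹ *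
      (x : ℂ) ^ (-(5/4 + t * Complex.I))

/-- The transition function `c_f(α)`. -/
noncomputable def cf (k : ℕ) (lam : ℕ → ℝ) (α : ℝ) : ℂ :=
  ((Real.pi ^ ((3:ℝ)/2) / 2 * α : ℝ) : ℂ) *
    ∑' n : ℕ+, ((lam n)^2 : ℝ) * Wk k (Real.pi^2 * (n : ℕ) * α)

open scoped FourierTransform Pointwise

theorem Nat.card_divisors_mul_le (a b : ℕ) :
    (a * b).divisors.card ≤ a.divisors.card * b.divisors.card := by
  rw [Nat.divisors_mul]
  exact Finset.card_mul_le

theorem Nat.card_divisors_sq_le_sum (n : ℕ) :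
    n.divisors.card ^ 2 ≤
      ∑ p ∈ n.divisorsAntidiagonal, p.1.divisors.card * p.2.divisors.card := by
  have hcard : n.divisorsAntidiagonal.card = n.divisors.card := by
    rw [← Nat.map_div_right_divisors, Finset.card_map]
  calc n.divisors.card ^ 2
      = ∑ p ∈ n.divisorsAntidiagonal, n.divisors.card := by
        rw [Finset.sum_const, hcard, smul_eq_mul, sq]
    _ ≤ _ := Finset.sum_le_sum fun p hp ↦ by
        rw [← (Nat.mem_divisorsAntidiagonal.mp hp).1]
        exact Nat.card_divisors_mul_le _ _

theorem summable_card_divisors_sq_mul_rpow {c : ℝ} (hc : 1 < c) :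
    Summable fun n : ℕ+ ↦ ((n : ℕ).divisors.card : ℝ) ^ 2 * ((n : ℕ) : ℝ) ^ (-c) := by
  let ζ : ArithmeticFunction ℂ := (ArithmeticFunction.zeta : ArithmeticFunction ℕ)
  have hζ : LSeriesSummable (fun n ↦ ζ n) (c : ℂ) := by
    have := (ArithmeticFunction.LSeriesSummable_zeta_iff (s := (c : ℂ))).mpr (by simpa using hc)
    simpa [ζ] using! this
  have hd : LSeriesSummable (fun n ↦ (ζ * ζ) n) (c : ℂ) :=
    ArithmeticFunction.LSeriesSummable_mul hζ hζ
  have hdd := ArithmeticFunction.LSeriesSummable_mul hd hd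
  have hdval (n : ℕ) : (ζ * ζ) n = (n.divisors.card : ℂ) := by
    simp only [ζ]
    rw [← ArithmeticFunction.natCoe_mul, ArithmeticFunction.natCoe_apply]
    rw [← ArithmeticFunction.sigma_zero_apply, ← ArithmeticFunction.zeta_mul_pow_eq_sigma]
    simp
  have hnorm := hdd.norm.comp_injective PNat.coe_injective
  refine hnorm.of_nonneg_of_le (fun n ↦ by positivity) fun n ↦ ?_
  have hn : (0 : ℝ) < (n : ℕ) := by exact_mod_cast n.pos
  have hval : ((ζ * ζ) * (ζ * ζ)) (n : ℕ) =
      ((∑ p ∈ (n : ℕ).divisorsAntidiagonal, p.1.divisors.card * p.2.divisors.card : ℕ) : ℂ) := by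
    rw [ArithmeticFunction.mul_apply]
    simp only [hdval]
    push_cast
    rfl
  rw [Function.comp_apply, LSeries.term_of_ne_zero n.ne_zero, hval, norm_div, Complex.norm_natCast,
    Complex.norm_natCast_cpow_of_pos n.pos, Complex.ofReal_re, Real.rpow_neg hn.le, ← div_eq_mul_inv]
  gcongr
  exact_mod_cast Nat.card_divisors_sq_le_sum n

theorem Complex.norm_Gamma_le_Gamma_re {s : ℂ} (hs : 0 < s.re) :
    ‖Complex.Gamma s‖ ≤ Real.Gamma s.re := by
  rw [Complex.Gamma_eq_integral hs, Real.Gamma_eq_integral hs, Complex.GammaIntegral]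
  refine (norm_integral_le_integral_norm _).trans_eq
    (setIntegral_congr_fun measurableSet_Ioi fun x hx ↦ ?_)
  rw [norm_mul, Complex.norm_of_nonneg (Real.exp_pos _).le, Complex.norm_cpow_eq_rpow_re_of_pos hx]
  simp

theorem Complex.abs_pow_mul_norm_Gamma_le (n : ℕ) {c : ℝ} (hc : 0 < c) (t : ℝ) :
    |t| ^ n * ‖Complex.Gamma (c + t * Complex.I)‖ ≤ Real.Gamma (c + n) := by
  induction n generalizing c with
  | zero => simpa using Complex.norm_Gamma_le_Gamma_re (s := c + t * Complex.I) (by simpa using hc)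
  | succ n ih =>
    have hre : ((c : ℂ) + t * Complex.I).re = c := by simp
    have him : ((c : ℂ) + t * Complex.I).im = t := by simp
    have hne : (c : ℂ) + t * Complex.I ≠ 0 := fun h ↦ by simp [h] at hre; exact hc.ne hre
    have ht : |t| ≤ ‖(c : ℂ) + t * Complex.I‖ := by
      simpa [him] using Complex.abs_im_le_norm ((c : ℂ) + t * Complex.I)
    calc |t| ^ (n + 1) * ‖Complex.Gamma (c + t * Complex.I)‖
        ≤ |t| ^ n * (‖(c : ℂ) + t * Complex.I‖ * ‖Complex.Gamma (c + t * Complex.I)‖) := by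
          rw [pow_succ, mul_assoc]
          gcongr
      _ = |t| ^ n * ‖Complex.Gamma ((c + 1 : ℝ) + t * Complex.I)‖ := by
          rw [← norm_mul, ← Complex.Gamma_add_one _ hne]
          congr 3
          push_cast
          ring
      _ ≤ Real.Gamma (c + 1 + n) := ih (by positivity)
      _ = Real.Gamma (c + (n + 1 : ℕ)) := by push_cast; ring_nf

theorem Complex.continuous_Gamma_vertical {c : ℝ} (hc : 0 < c) :
    Continuous fun t : ℝ ↦ Complex.Gamma (c + t * Complex.I) := by
  refine continuous_iff_continuousAt.mpr fun t ↦ ?_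
  refine ContinuousAt.comp (g := Complex.Gamma)
    (Complex.differentiableAt_Gamma _ fun m h ↦ ?_).continuousAt (by fun_prop)
  have := congrArg Complex.re h
  simp at this
  have : (0 : ℝ) ≤ m := m.cast_nonneg
  linarith

theorem Complex.integrable_pow_mul_norm_Gamma (n : ℕ) {c : ℝ} (hc : 0 < c) :
    Integrable fun t : ℝ ↦ ‖t‖ ^ n * ‖Complex.Gamma (c + t * Complex.I)‖ := by
  refine (integrable_inv_one_add_sq.const_mul
    (Real.Gamma (c + n) + Real.Gamma (c + (n + 2 : ℕ)))).mono'
    ((continuous_norm.pow n).mul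
      (Complex.continuous_Gamma_vertical hc).norm).aestronglyMeasurable (ae_of_all _ fun t ↦ ?_)
  rw [Real.norm_of_nonneg (by positivity), ← div_eq_mul_inv, le_div_iff₀ (by positivity)]
  have h₀ := Complex.abs_pow_mul_norm_Gamma_le n hc t
  have h₂ := Complex.abs_pow_mul_norm_Gamma_le (n + 2) hc t
  rw [pow_add, sq_abs] at h₂
  rw [Real.norm_eq_abs]
  linarith

theorem contDiffOn_integral_mul_cpow {g : ℝ → ℂ} (c : ℝ)
    (hg : ∀ n : ℕ, Integrable fun t : ℝ ↦ ‖t‖ ^ n * ‖g t‖) :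
    ContDiffOn ℝ (⊤ : ℕ∞) (fun x : ℝ ↦ ∫ t : ℝ, g t * (x : ℂ) ^ (-(c + t * Complex.I)))
      (Set.Ioi 0) := by
  have hF : ContDiff ℝ (⊤ : ℕ∞) (𝓕 g) := Real.contDiff_fourier fun n _ ↦ hg n
  have hlog : ContDiffOn ℝ (⊤ : ℕ∞) Real.log (Set.Ioi 0) :=
    Real.contDiffOn_log.mono fun x hx ↦ (Set.mem_Ioi.mp hx).ne'
  have hpow : ContDiffOn ℝ (⊤ : ℕ∞) (fun x : ℝ ↦ ((x ^ (-c) : ℝ) : ℂ)) (Set.Ioi 0) :=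
    Complex.ofRealCLM.contDiff.comp_contDiffOn
      (contDiffOn_id.rpow_const_of_ne fun x hx ↦ (Set.mem_Ioi.mp hx).ne')
  refine (hpow.mul (hF.comp_contDiffOn (hlog.div_const (2 * π)))).congr fun x hx ↦ ?_
  have hx : 0 < x := hx
  have hx' : (x : ℂ) ≠ 0 := by exact_mod_cast hx.ne'
  rw [Function.comp_apply, Real.fourier_real_eq_integral_exp_smul,
    ← integral_const_mul]
  refine integral_congr_ae (ae_of_all _ fun t ↦ ?_)
  simp only [smul_eq_mul]
  rw [neg_add, Complex.cpow_add _ _ hx', Complex.ofReal_cpow hx.le,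
    Complex.cpow_def_of_ne_zero hx' (-(t * Complex.I)), ← Complex.ofReal_log hx.le]
  have h : (Real.log x : ℂ) * -(t * Complex.I) =
      ((-2 * π * t * (Real.log x / (2 * π)) : ℝ) : ℂ) * Complex.I := by
    have : (π : ℂ) ≠ 0 := by exact_mod_cast Real.pi_ne_zero
    push_cast
    field_simp
  rw [h]
  push_cast
  ring

theorem continuous_tsum_mul_cpow {a : ℕ+ → ℂ} {c : ℝ}
    (ha : Summable fun n : ℕ+ ↦ ‖a n‖ * ((n : ℕ) : ℝ) ^ (-c)) :
    Continuous fun t : ℝ ↦ ∑' n : ℕ+, a n * ((n : ℕ) : ℂ) ^ (-(c + t * Complex.I)) := by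
  refine continuous_tsum (fun n ↦ ?_) ha fun n t ↦ ?_
  · have hn : ((n : ℕ) : ℂ) ≠ 0 := by exact_mod_cast n.ne_zero
    exact continuous_const.mul (Continuous.const_cpow (by fun_prop) (Or.inl hn))
  · rw [norm_mul, Complex.norm_natCast_cpow_of_pos n.pos]
    simp

theorem norm_tsum_mul_cpow_le {a : ℕ+ → ℂ} {c : ℝ}
    (ha : Summable fun n : ℕ+ ↦ ‖a n‖ * ((n : ℕ) : ℝ) ^ (-c)) (t : ℝ) :
    ‖∑' n : ℕ+, a n * ((n : ℕ) : ℂ) ^ (-(c + t * Complex.I))‖ ≤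
      ∑' n : ℕ+, ‖a n‖ * ((n : ℕ) : ℝ) ^ (-c) := by
  refine tsum_of_norm_bounded ha.hasSum fun n ↦ ?_
  rw [norm_mul, Complex.norm_natCast_cpow_of_pos n.pos]
  simp

theorem tsum_mul_integral_mul_cpow {a : ℕ+ → ℂ} {c : ℝ}
    (ha : Summable fun n : ℕ+ ↦ ‖a n‖ * ((n : ℕ) : ℝ) ^ (-c)) {g : ℝ → ℂ} (hg : Integrable g)
    {x : ℝ} (hx : 0 < x) :
    ∑' n : ℕ+, a n * ∫ t : ℝ, g t * (((n : ℕ) * x : ℝ) : ℂ) ^ (-(c + t * Complex.I)) =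
      ∫ t : ℝ, (g t * ∑' n : ℕ+, a n * ((n : ℕ) : ℂ) ^ (-(c + t * Complex.I))) *
        (x : ℂ) ^ (-(c + t * Complex.I)) := by
  have hpos (n : ℕ+) : (0 : ℝ) < (n : ℕ) * x := mul_pos (by exact_mod_cast n.pos) hx
  have hnorm (n : ℕ+) (t : ℝ) :
      ‖a n * (g t * (((n : ℕ) * x : ℝ) : ℂ) ^ (-(c + t * Complex.I)))‖ =
        ‖a n‖ * ((n : ℕ) : ℝ) ^ (-c) * x ^ (-c) * ‖g t‖ := by
    rw [norm_mul, norm_mul, Complex.norm_cpow_eq_rpow_re_of_pos (hpos n),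
      show (-((c : ℂ) + t * Complex.I)).re = -c by simp,
      Real.mul_rpow (Nat.cast_nonneg _) hx.le]
    ring
  have h_integral (n : ℕ+) :
      Integrable fun t : ℝ ↦ a n * (g t * (((n : ℕ) * x : ℝ) : ℂ) ^ (-(c + t * Complex.I))) := by
    refine (hg.norm.const_mul (‖a n‖ * ((n : ℕ) : ℝ) ^ (-c) * x ^ (-c))).mono' ?_
      (ae_of_all _ fun t ↦ (hnorm n t).le)
    have hcont : Continuous fun t : ℝ ↦ (((n : ℕ) * x : ℝ) : ℂ) ^ (-(c + t * Complex.I)) :=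
      Continuous.const_cpow (by fun_prop) (Or.inl (by exact_mod_cast (hpos n).ne'))
    exact (hg.aestronglyMeasurable.mul hcont.aestronglyMeasurable).const_mul _
  have hsum : Summable fun n : ℕ+ ↦
      ∫ t : ℝ, ‖a n * (g t * (((n : ℕ) * x : ℝ) : ℂ) ^ (-(c + t * Complex.I)))‖ := by
    simp only [hnorm, integral_const_mul]
    exact (ha.mul_right _).mul_right _
  simp only [← integral_const_mul]
  rw [integral_tsum_of_summable_integral_norm h_integral hsum]
  refine integral_congr_ae (ae_of_all _ fun t ↦ ?_)
  simp only
  rw [← tsum_mul_left, ← tsum_mul_right]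
  refine tsum_congr fun n ↦ ?_
  rw [Complex.ofReal_mul, Complex.mul_cpow_ofReal_nonneg (Nat.cast_nonneg _) hx.le,
    Complex.ofReal_natCast]
  ring

/-- The Gamma factor of the kernel `Wk`, on the line `Re s = 5/4`. -/
noncomputable def gammaFactor (k : ℕ) (t : ℝ) : ℂ :=
  Complex.Gamma ((k : ℂ) + 1/4 + t * Complex.I) *
    Complex.Gamma (3/4 + t * Complex.I) *
    (Complex.Gamma (3/4 - t * Complex.I))⁻¹

theorem norm_gammaFactor (k : ℕ) (t : ℝ) :
    ‖gammaFactor k t‖ = ‖Complex.Gamma ((k + 1/4 : ℝ) + t * Complex.I)‖ := by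
  have hconj : (3/4 - t * Complex.I : ℂ) = (starRingEnd ℂ) (3/4 + t * Complex.I) := by
    simp [sub_eq_add_neg, map_ofNat]
  have hne : Complex.Gamma (3/4 + t * Complex.I) ≠ 0 :=
    Complex.Gamma_ne_zero_of_re_pos (by simp)
  rw [gammaFactor, hconj, Complex.Gamma_conj, norm_mul, norm_mul, norm_inv, Complex.norm_conj,
    mul_assoc, mul_inv_cancel₀ (norm_ne_zero_iff.mpr hne), mul_one]
  push_cast
  rfl

theorem continuous_gammaFactor (k : ℕ) : Continuous (gammaFactor k) := by
  have h₁ := Complex.continuous_Gamma_vertical (c := k + 1/4) (by positivity)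
  have h₂ := Complex.continuous_Gamma_vertical (c := 3/4) (by norm_num)
  have h₃ := h₂.comp continuous_neg
  have hne (t : ℝ) : Complex.Gamma (3/4 - t * Complex.I) ≠ 0 :=
    Complex.Gamma_ne_zero_of_re_pos (by simp)
  push_cast at h₁ h₂
  refine (h₁.mul h₂).mul (Continuous.inv₀ ?_ hne)
  refine h₃.congr fun t ↦ ?_
  simp [sub_eq_add_neg]

theorem integrable_gammaFactor (k : ℕ) : Integrable (gammaFactor k) := by
  refine (integrable_norm_iff (continuous_gammaFactor k).aestronglyMeasurable).mp ?_
  simp only [norm_gammaFactor]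
  simpa using Complex.integrable_pow_mul_norm_Gamma 0 (c := k + 1/4) (by positivity)

theorem Wk_eq (k : ℕ) (x : ℝ) :
    Wk k x = (1 / (2 * π)) *
      ∫ t : ℝ, gammaFactor k t * (x : ℂ) ^ (-((5/4 : ℝ) + t * Complex.I)) := by
  simp [Wk, gammaFactor]

/-- `c_f` is infinitely differentiable on `(0,∞)`. -/
theorem cf_contDiffOn (k : ℕ) (hk : Even k) (hk0 : 0 < k)
    (lam : ℕ → ℝ) (hlam1 : lam 1 = 1)
    (hHecke : ∀ m n : ℕ, 0 < m → 0 < n →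
      lam m * lam n = ∑ d ∈ (Nat.gcd m n).divisors, lam (m * n / d ^ 2))
    (hDeligne : ∀ n : ℕ, 0 < n → |lam n| ≤ (n.divisors.card : ℝ)) :
    ContDiffOn ℝ (⊤ : ℕ∞) (cf k lam) (Set.Ioi (0 : ℝ)) := by
  let a : ℕ+ → ℂ := fun n ↦ ((lam n ^ 2 : ℝ) : ℂ)
  have ha : Summable fun n : ℕ+ ↦ ‖a n‖ * ((n : ℕ) : ℝ) ^ (-(5/4 : ℝ)) := by
    refine (summable_card_divisors_sq_mul_rpow (c := 5/4) (by norm_num)).of_nonneg_of_le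
      (fun n ↦ by positivity) fun n ↦ ?_
    simp only [a, Complex.norm_real, norm_pow, Real.norm_eq_abs]
    gcongr
    exact hDeligne n n.pos
  let D : ℝ → ℂ := fun t ↦ ∑' n : ℕ+, a n * ((n : ℕ) : ℂ) ^ (-((5/4 : ℝ) + t * Complex.I))
  have hD : Continuous D := continuous_tsum_mul_cpow ha
  have hmoment (m : ℕ) : Integrable fun t : ℝ ↦ ‖t‖ ^ m * ‖gammaFactor k t * D t‖ := by
    refine ((Complex.integrable_pow_mul_norm_Gamma m (c := k + 1/4) (by positivity)).mul_const
      (∑' n : ℕ+, ‖a n‖ * ((n : ℕ) : ℝ) ^ (-(5/4 : ℝ)))).mono'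
      ((continuous_norm.pow m).mul
        ((continuous_gammaFactor k).mul hD).norm).aestronglyMeasurable (ae_of_all _ fun t ↦ ?_)
    rw [Real.norm_of_nonneg (by positivity), norm_mul, norm_gammaFactor, ← mul_assoc]
    gcongr
    exact norm_tsum_mul_cpow_le ha t
  have h_integral := contDiffOn_integral_mul_cpow (5/4) hmoment
  have hscale : ContDiffOn ℝ (⊤ : ℕ∞) (fun α : ℝ ↦ π ^ 2 * α) (Set.Ioi 0) := by fun_prop
  have hcomp := h_integral.comp hscale fun α (hα : 0 < α) ↦ Set.mem_Ioi.mpr (by positivity)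
  have hlin : ContDiffOn ℝ (⊤ : ℕ∞) (fun α : ℝ ↦ ((π ^ ((3:ℝ)/2) / 2 * α : ℝ) : ℂ))
      (Set.Ioi 0) :=
    Complex.ofRealCLM.contDiff.comp_contDiffOn (contDiffOn_const.mul contDiffOn_id)
  refine (hlin.mul ((contDiffOn_const (c := (1 / (2 * π) : ℂ))).mul hcomp)).congr fun α hα ↦ ?_
  have hα : 0 < α := hα
  have hswap := tsum_mul_integral_mul_cpow ha (integrable_gammaFactor k)
    (x := π ^ 2 * α) (by positivity)
  simp only [Function.comp_apply]
  rw [cf, ← hswap, ← tsum_mul_left (a := (1 / (2 * π) : ℂ))]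
  congr 1
  refine tsum_congr fun n ↦ ?_
  rw [Wk_eq, show π ^ 2 * ((n : ℕ) : ℝ) * α = (n : ℕ) * (π ^ 2 * α) by ring]
  ring
end

section
/- Let k ≥ 2 be an integer. The function W_k is real-valued and infinitely differentiable on (0,∞), and it decays faster than any polynomial at infinity: for every positive integer N there exists a constant C > 0 (depending on k and N) such that |W_k(x)| ≤ C x^(−N) for all x ≥ 1. -/
open MeasureTheory Real Filter Finset

/-- The Laplace transform of `t ^ (a - 1)` is holomorphic in the right half-plane. -/
lemma differentiableOn_laplace_cpow {a : ℂ} (ha : 0 < a.re) :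
    DifferentiableOn ℂ
      (fun r : ℂ => ∫ t : ℝ in Set.Ioi 0, (t : ℂ) ^ (a - 1) * Complex.exp (-(r * t)))
      {r : ℂ | 0 < r.re} := by
  intro r₀ hr₀
  have hr₀' : 0 < r₀.re := hr₀
  have hcont : ContinuousOn (fun t : ℝ => (t : ℂ) ^ (a - 1)) (Set.Ioi 0) := fun t ht =>
    (Complex.continuousAt_ofReal_cpow_const t (a - 1) (Or.inr (ne_of_gt ht))).continuousWithinAt
  have hmeas (r : ℂ) : AEStronglyMeasurable
      (fun t : ℝ => (t : ℂ) ^ (a - 1) * Complex.exp (-(r * t)))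
      (volume.restrict (Set.Ioi 0)) :=
    (hcont.mul (by fun_prop)).aestronglyMeasurable measurableSet_Ioi
  have hnorm (r : ℂ) {t : ℝ} (ht : 0 < t) :
      ‖(t : ℂ) ^ (a - 1) * Complex.exp (-(r * t))‖ = t ^ (a.re - 1) * rexp (-r.re * t) := by
    rw [norm_mul, Complex.norm_cpow_eq_rpow_re_of_pos ht, Complex.norm_exp]
    simp
  have key := hasDerivAt_integral_of_dominated_loc_of_deriv_le
    (μ := volume.restrict (Set.Ioi (0 : ℝ))) (x₀ := r₀) (s := {r : ℂ | r₀.re / 2 < r.re})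
    (F := fun r (t : ℝ) => (t : ℂ) ^ (a - 1) * Complex.exp (-(r * t)))
    (F' := fun r (t : ℝ) => (t : ℂ) ^ (a - 1) * Complex.exp (-(r * t)) * (-t))
    (bound := fun t => t ^ a.re * rexp (-(r₀.re / 2) * t ^ (1 : ℝ)))
    ((isOpen_lt continuous_const Complex.continuous_re).mem_nhds (by simpa using hr₀'))
    (Eventually.of_forall hmeas) ?_ ?_ ?_ ?_ ?_
  · exact key.2.differentiableAt.differentiableWithinAt
  · have h := integrableOn_rpow_mul_exp_neg_mul_rpow (s := a.re - 1) (by linarith) one_pos hr₀'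
    refine Integrable.mono' h (hmeas r₀) ?_
    filter_upwards [ae_restrict_mem measurableSet_Ioi] with t ht
    rw [hnorm r₀ ht, rpow_one]
  · exact (hmeas r₀).mul (by fun_prop)
  · filter_upwards [ae_restrict_mem measurableSet_Ioi] with t ht r hr
    have ht' : 0 < t := ht
    have hr' : r₀.re / 2 < r.re := hr
    rw [norm_mul, hnorm r ht, rpow_one, norm_neg, Complex.norm_real, norm_of_nonneg ht'.le,
      mul_right_comm, ← rpow_add_one ht'.ne', sub_add_cancel]
    gcongr
  · exact integrableOn_rpow_mul_exp_neg_mul_rpow (by linarith) one_pos (by linarith)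
  · refine Eventually.of_forall fun t r _ => ?_
    have h : HasDerivAt (fun r : ℂ => -(r * t)) (-(1 * (t : ℂ))) r :=
      ((hasDerivAt_id r).mul_const (t : ℂ)).neg
    convert! (h.cexp.const_mul ((t : ℂ) ^ (a - 1))) using 1
    ring

/-- The Gamma integral along a rotated ray. -/
lemma integral_cpow_mul_cexp_neg_mul_Ioi {a r : ℂ} (ha : 0 < a.re) (hr : 0 < r.re) :
    ∫ t : ℝ in Set.Ioi 0, (t : ℂ) ^ (a - 1) * Complex.exp (-(r * t)) =
      r ^ (-a) * Complex.Gamma a := by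
  have hopen : IsOpen {r : ℂ | 0 < r.re} := isOpen_lt continuous_const Complex.continuous_re
  have h₁ := (differentiableOn_laplace_cpow ha).analyticOnNhd hopen
  have h₂ : AnalyticOnNhd ℂ (fun r : ℂ => r ^ (-a) * Complex.Gamma a) {r : ℂ | 0 < r.re} := by
    refine DifferentiableOn.analyticOnNhd (fun z hz => ?_) hopen
    have hz : z ∈ Complex.slitPlane := Or.inl hz
    exact ((differentiableAt_id.cpow_const hz).mul_const _).differentiableWithinAt
  refine h₁.eqOn_of_preconnected_of_frequently_eq h₂ (z₀ := 1)
    (convex_halfSpace_re_gt 0).isPreconnected (by simp) ?_ hr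
  have htend : Tendsto (fun x : ℝ => (x : ℂ)) (nhdsWithin 1 (Set.Ioi 1)) (nhdsWithin 1 {1}ᶜ) := by
    refine tendsto_nhdsWithin_iff.2 ⟨?_, ?_⟩
    · exact (Complex.continuous_ofReal.tendsto' 1 1 (by simp)).mono_left nhdsWithin_le_nhds
    · filter_upwards [self_mem_nhdsWithin] with x hx
      simpa using (ne_of_gt hx : x ≠ 1)
  refine htend.frequently (Eventually.frequently ?_)
  filter_upwards [self_mem_nhdsWithin] with x hx
  have hx0 : 0 < x := zero_lt_one.trans hx
  rw [Complex.integral_cpow_mul_exp_neg_mul_Ioi ha hx0, one_div, Complex.cpow_neg,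
    Complex.inv_cpow _ _ (by rw [Complex.arg_ofReal_of_nonneg hx0.le]; exact pi_ne_zero.symm)]

lemma norm_Gamma_le_exp_neg_mul_im {a : ℂ} (ha : 0 < a.re) {θ : ℝ} (h₁ : -(π / 2) < θ)
    (h₂ : θ < π / 2) :
    ‖Complex.Gamma a‖ ≤ rexp (-(θ * a.im)) * ((1 / cos θ) ^ a.re * Real.Gamma a.re) := by
  have hcos : 0 < cos θ := cos_pos_of_mem_Ioo ⟨h₁, h₂⟩
  set r : ℂ := Complex.exp (θ * Complex.I) with hr
  have hre : r.re = cos θ := Complex.exp_ofReal_mul_I_re θ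
  have hpow : r ^ (-a) = Complex.exp (θ * Complex.I * (-a)) := by
    rw [Complex.cpow_def_of_ne_zero (hr ▸ Complex.exp_ne_zero _), Complex.log_exp]
    · simp; linarith [pi_pos]
    · simp; linarith [pi_pos]
  have hint := integral_cpow_mul_cexp_neg_mul_Ioi (r := r) ha (by rwa [hre])
  have hle : ‖r ^ (-a) * Complex.Gamma a‖ ≤ (1 / cos θ) ^ a.re * Real.Gamma a.re := by
    rw [← hint, ← Real.integral_rpow_mul_exp_neg_mul_Ioi ha hcos]
    refine (norm_integral_le_integral_norm _).trans_eq
      (setIntegral_congr_fun measurableSet_Ioi fun t ht => ?_)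
    have ht' : 0 < t := ht
    simp only [norm_mul, Complex.norm_cpow_eq_rpow_re_of_pos ht', Complex.norm_exp]
    simp [hre]
  have hn : ‖r ^ (-a)‖ = rexp (θ * a.im) := by
    rw [hpow, Complex.norm_exp]; simp
  rw [norm_mul, hn] at hle
  rw [Real.exp_neg, ← div_eq_inv_mul, le_div_iff₀ (exp_pos _), mul_comm]
  exact hle

lemma norm_Gamma_le_exp_neg_mul_abs_im {a : ℂ} (ha : 0 < a.re) {θ : ℝ} (h₀ : 0 ≤ θ)
    (h₂ : θ < π / 2) :
    ‖Complex.Gamma a‖ ≤ rexp (-(θ * |a.im|)) * ((1 / cos θ) ^ a.re * Real.Gamma a.re) := by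
  rcases le_total 0 a.im with h | h
  · rw [abs_of_nonneg h]
    exact norm_Gamma_le_exp_neg_mul_im ha (by linarith [pi_pos]) h₂
  · have := norm_Gamma_le_exp_neg_mul_im ha (θ := -θ) (by linarith) (by linarith [pi_pos])
    rw [abs_of_nonpos h]
    simpa using this

lemma exists_norm_Gamma_le {θ : ℝ} (h₀ : 0 ≤ θ) (h₂ : θ < π / 2) {l : ℝ} (hl : 0 < l) (b : ℝ) :
    ∃ C, ∀ a : ℂ, l ≤ a.re → a.re ≤ b → ‖Complex.Gamma a‖ ≤ C * rexp (-(θ * |a.im|)) := by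
  have hcos : 0 < cos θ := cos_pos_of_mem_Ioo ⟨by linarith [pi_pos], h₂⟩
  have hc : ContinuousOn (fun σ : ℝ => (1 / cos θ) ^ σ * Real.Gamma σ) (Set.Icc l b) := by
    intro σ hσ
    have h1 : ContinuousAt Real.Gamma σ :=
      (Real.differentiableAt_Gamma fun m => by
        have : (0 : ℝ) ≤ m := m.cast_nonneg
        linarith [hσ.1]).continuousAt
    have h2 : ContinuousAt (fun σ : ℝ => (1 / cos θ) ^ σ) σ :=
      (Real.continuous_const_rpow (by positivity)).continuousAt
    exact (h2.mul h1).continuousWithinAt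
  obtain ⟨C, hC⟩ := isCompact_Icc.exists_bound_of_continuousOn hc
  refine ⟨C, fun a h1 h2 => ?_⟩
  refine (norm_Gamma_le_exp_neg_mul_abs_im (hl.trans_le h1) h₀ h₂).trans ?_
  rw [mul_comm]
  gcongr
  exact (le_norm_self _).trans (hC a.re ⟨h1, h2⟩)

lemma norm_sin_le_exp_abs_im (z : ℂ) : ‖Complex.sin z‖ ≤ rexp |z.im| := by
  have h₁ : ‖Complex.exp (-z * Complex.I)‖ ≤ rexp |z.im| := by
    rw [Complex.norm_exp]; simpa using le_abs_self z.im
  have h₂ : ‖Complex.exp (z * Complex.I)‖ ≤ rexp |z.im| := by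
    rw [Complex.norm_exp]; simpa using neg_le_abs z.im
  rw [Complex.sin, norm_div, norm_mul, Complex.norm_I, mul_one, Complex.norm_ofNat]
  linarith [norm_sub_le (Complex.exp (-z * Complex.I)) (Complex.exp (z * Complex.I))]

lemma inv_Gamma_one_sub {z : ℂ} (hz : 0 < z.re) :
    (Complex.Gamma (1 - z))⁻¹ = Complex.Gamma z * Complex.sin (π * z) / π := by
  have h := Complex.Gamma_mul_Gamma_one_sub z
  have hG : Complex.Gamma z ≠ 0 := Complex.Gamma_ne_zero_of_re_pos hz
  have : Complex.Gamma (1 - z) = π / Complex.sin (π * z) / Complex.Gamma z := by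
    rw [← h]; field_simp
  rw [this, inv_div, div_div_eq_mul_div]

lemma integrable_abs_pow_mul_exp_neg_mul_abs (n : ℕ) {c : ℝ} (hc : 0 < c) :
    Integrable fun t : ℝ => |t| ^ n * rexp (-(c * |t|)) := by
  have h := integrableOn_rpow_mul_exp_neg_mul_rpow (s := n)
    (by linarith [n.cast_nonneg (α := ℝ)]) one_pos hc
  have hpos : IntegrableOn (fun t : ℝ => |t| ^ n * rexp (-(c * |t|))) (Set.Ioi 0) := by
    refine h.congr_fun (fun t ht => ?_) measurableSet_Ioi
    simp [abs_of_pos (Set.mem_Ioi.1 ht)]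
  have hneg : IntegrableOn (fun t : ℝ => |t| ^ n * rexp (-(c * |t|))) (Set.Iio 0) := by
    simpa using IntegrableOn.comp_neg_Iio (c := 0)
      (f := fun t : ℝ => |t| ^ n * rexp (-(c * |t|))) (by simpa using hpos)
  rw [← integrableOn_univ, ← Set.Iic_union_Ioi (a := (0 : ℝ))]
  exact ((integrableOn_Iic_iff_integrableOn_Iio (by simp)).2 hneg).union hpos

/-- Shifting a vertical line of integration inside a strip of exponential decay. -/
lemma integral_vertical_eq_of_exp_decay {f : ℂ → ℂ} {a b c C : ℝ} (hab : a ≤ b) (hc : 0 < c)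
    (hf : ∀ z : ℂ, a ≤ z.re → z.re ≤ b → DifferentiableAt ℂ f z)
    (hC : ∀ z : ℂ, a ≤ z.re → z.re ≤ b → ‖f z‖ ≤ C * rexp (-(c * |z.im|))) :
    ∫ t : ℝ, f (a + t * Complex.I) = ∫ t : ℝ, f (b + t * Complex.I) := by
  have hexp : Integrable fun t : ℝ => C * rexp (-(c * |t|)) :=
    by
    simpa using (integrable_abs_pow_mul_exp_neg_mul_abs 0 hc).const_mul C
  have hint {σ : ℝ} (h1 : a ≤ σ) (h2 : σ ≤ b) :
      Integrable fun t : ℝ => f (σ + t * Complex.I) := by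
    refine hexp.mono' (Continuous.aestronglyMeasurable ?_) (Eventually.of_forall fun t => ?_)
    · refine continuous_iff_continuousAt.2 fun t => ?_
      exact ContinuousAt.comp (f := fun t : ℝ => (σ : ℂ) + t * Complex.I)
        (hf _ (by simpa using h1) (by simpa using h2)).continuousAt (by fun_prop)
    · simpa using hC (σ + t * Complex.I) (by simpa using h1) (by simpa using h2)
  have hA := intervalIntegral_tendsto_integral (hint le_rfl hab) tendsto_neg_atTop_atBot tendsto_id
  have hB := intervalIntegral_tendsto_integral (hint hab le_rfl) tendsto_neg_atTop_atBot tendsto_id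
  have hhor (s : ℝ) (hs : |s| = 1) :
      Tendsto (fun T : ℝ => ∫ x : ℝ in a..b, f (x + (s * T : ℝ) * Complex.I)) atTop (nhds 0) := by
    have hlim : Tendsto (fun T : ℝ => C * rexp (-(c * T)) * |b - a|) atTop (nhds 0) := by
      have : Tendsto (fun T : ℝ => rexp (-(c * T))) atTop (nhds 0) :=
        tendsto_exp_neg_atTop_nhds_zero.comp (tendsto_id.const_mul_atTop hc)
      simpa using (this.const_mul C).mul_const |b - a|
    refine squeeze_zero_norm' ?_ hlim
    filter_upwards [eventually_ge_atTop 0] with T hT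
    refine intervalIntegral.norm_integral_le_of_norm_le_const fun x hx => ?_
    rw [Set.uIoc_of_le hab] at hx
    refine (hC _ (by simpa using hx.1.le) (by simpa using hx.2)).trans_eq ?_
    simp [abs_mul, hs, abs_of_nonneg hT]
  have hrect (T : ℝ) :
      (∫ t : ℝ in (-T)..T, f (b + t * Complex.I)) - (∫ t : ℝ in (-T)..T, f (a + t * Complex.I)) =
      Complex.I * ((∫ x : ℝ in a..b, f (x + ((-1) * T : ℝ) * Complex.I)) -
        ∫ x : ℝ in a..b, f (x + (1 * T : ℝ) * Complex.I)) := by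
    have h := Complex.integral_boundary_rect_eq_zero_of_differentiableOn f
      (⟨a, -T⟩ : ℂ) (⟨b, T⟩ : ℂ) (fun z hz => by
        rw [Complex.mem_reProdIm, Set.uIcc_of_le hab] at hz
        exact (hf z hz.1.1 hz.1.2).differentiableWithinAt)
    simp only [smul_eq_mul] at h
    rw [neg_one_mul, one_mul]
    linear_combination (-Complex.I) * h + ((∫ t : ℝ in (-T)..T, f (b + t * Complex.I)) -
      (∫ t : ℝ in (-T)..T, f (a + t * Complex.I))) * Complex.I_sq
  have h0 := ((hhor (-1) (by simp)).sub (hhor 1 (by simp))).const_mul Complex.I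
  rw [sub_zero, mul_zero] at h0
  exact (sub_eq_zero.1 (tendsto_nhds_unique ((hB.sub hA).congr fun T => hrect T) h0)).symm

/-- The Mellin transform of `Wk k`. -/
noncomputable def mellinWk (k : ℕ) (s : ℂ) : ℂ :=
  Complex.Gamma (s + k - 1) * Complex.Gamma (s - 1 / 2) * (Complex.Gamma (2 - s))⁻¹

lemma exists_norm_mellinWk_le (k : ℕ) (b : ℝ) :
    ∃ C, ∀ s : ℂ, 5 / 4 ≤ s.re → s.re ≤ b →
      ‖mellinWk k s‖ ≤ C * rexp (-(π / 5 * |s.im|)) := by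
  obtain ⟨C, hC⟩ := exists_norm_Gamma_le (θ := 2 * π / 5) (by positivity)
    (by linarith [pi_pos]) (l := 1 / 4) (by norm_num) (b + k)
  refine ⟨C ^ 3 / π, fun s h1 h2 => ?_⟩
  have hk : (0 : ℝ) ≤ k := k.cast_nonneg
  have g1 := hC (s + k - 1) (by simp; linarith) (by simp; linarith)
  have g2 := hC (s - 1 / 2) (by simp; linarith) (by simp; linarith)
  have g3 := hC (s - 1) (by simp; linarith) (by simp; linarith)
  have g4 := norm_sin_le_exp_abs_im (π * (s - 1))
  simp only [Complex.add_im, Complex.sub_im, Complex.natCast_im, Complex.one_im, add_zero,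
    sub_zero, Complex.im_ofReal_mul, abs_mul, abs_of_pos pi_pos] at g1 g2 g3 g4
  have him : ((1 : ℂ) / 2).im = 0 := by simp
  rw [him, sub_zero] at g2
  rw [mellinWk, show (2 : ℂ) - s = 1 - (s - 1) by ring,
    inv_Gamma_one_sub (by simp; linarith), norm_mul, norm_mul, norm_div, norm_mul,
    Complex.norm_real, norm_of_nonneg pi_pos.le]
  have hE : rexp (-(π / 5 * |s.im|)) =
      rexp (-(2 * π / 5 * |s.im|)) ^ 3 * rexp (π * |s.im|) := by
    rw [← Real.exp_nat_mul, ← Real.exp_add]; congr 1; push_cast; ring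
  have hC0 : 0 ≤ C * rexp (-(2 * π / 5 * |s.im|)) := (norm_nonneg _).trans g1
  rw [hE]
  calc _ ≤ (C * rexp (-(2 * π / 5 * |s.im|))) * (C * rexp (-(2 * π / 5 * |s.im|))) *
        ((C * rexp (-(2 * π / 5 * |s.im|))) * rexp (π * |s.im|) / π) := by gcongr
    _ = _ := by ring

lemma differentiableAt_Gamma_of_re_pos {z : ℂ} (hz : 0 < z.re) :
    DifferentiableAt ℂ Complex.Gamma z :=
  Complex.differentiableAt_Gamma z fun m h => by
    have : (0 : ℝ) ≤ m := m.cast_nonneg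
    rw [h] at hz
    simp at hz
    linarith

lemma differentiableAt_mellinWk (k : ℕ) {s : ℂ} (hs : 5 / 4 ≤ s.re) :
    DifferentiableAt ℂ (mellinWk k) s := by
  have hk : (0 : ℝ) ≤ k := k.cast_nonneg
  refine ((DifferentiableAt.comp s (g := Complex.Gamma) (f := fun s : ℂ => s + k - 1)
    (differentiableAt_Gamma_of_re_pos (by simp; linarith)) (by fun_prop)).mul
    (DifferentiableAt.comp s (g := Complex.Gamma) (f := fun s : ℂ => s - 1 / 2)
    (differentiableAt_Gamma_of_re_pos (by simp; linarith)) (by fun_prop))).mul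
    (DifferentiableAt.comp s (g := fun s => (Complex.Gamma s)⁻¹) (f := fun s : ℂ => 2 - s)
    (Complex.differentiable_one_div_Gamma _) (by fun_prop))

lemma continuous_mellinWk_vertical (k : ℕ) {σ : ℝ} (hσ : 5 / 4 ≤ σ) :
    Continuous fun t : ℝ => mellinWk k (σ + t * Complex.I) :=
  continuous_iff_continuousAt.2 fun t =>
    ContinuousAt.comp (f := fun t : ℝ => (σ : ℂ) + t * Complex.I)
      (differentiableAt_mellinWk k (by simpa using hσ)).continuousAt (by fun_prop)

lemma Wk_eq_integral_mellinWk (k : ℕ) (x : ℝ) :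
    Wk k x = 1 / (2 * π) * ∫ t : ℝ, mellinWk k ((5 / 4 : ℝ) + t * Complex.I) *
      (x : ℂ) ^ (-((5 / 4 : ℝ) + t * Complex.I)) := by
  rw [Wk]
  congr 2 with t
  rw [mellinWk]
  push_cast
  congr 4 <;> ring_nf

lemma conj_mellinWk (k : ℕ) (s : ℂ) :
    (starRingEnd ℂ) (mellinWk k s) = mellinWk k ((starRingEnd ℂ) s) := by
  simp only [mellinWk, map_mul, map_inv₀, ← Complex.Gamma_conj, map_sub, map_add, map_natCast,
    map_one, map_div₀, map_ofNat]

lemma Wk_im {k : ℕ} {x : ℝ} (hx : 0 < x) : (Wk k x).im = 0 := by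
  rw [← Complex.conj_eq_iff_im, Wk_eq_integral_mellinWk, map_mul, ← integral_conj,
    ← integral_neg_eq_self]
  congr 1
  · simp [map_ofNat]
  · congr 1 with t
    have harg : (x : ℂ).arg ≠ π := by
      rw [Complex.arg_ofReal_of_nonneg hx.le]; exact pi_ne_zero.symm
    have hpow := Complex.cpow_conj (x : ℂ) (-((5 / 4 : ℝ) + (-t : ℝ) * Complex.I)) harg
    rw [Complex.conj_ofReal] at hpow
    rw [map_mul, conj_mellinWk, ← hpow]
    simp [map_ofNat]

/-- In logarithmic coordinates `Wk k` is, up to a power, a Fourier transform. -/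
lemma Wk_eq_fourier (k : ℕ) {x : ℝ} (hx : 0 < x) :
    Wk k x = 1 / (2 * π) * ((x ^ (-(5 / 4) : ℝ) : ℝ) *
      FourierTransform.fourier (fun t : ℝ => mellinWk k ((5 / 4 : ℝ) + t * Complex.I))
        (log x / (2 * π))) := by
  rw [Wk_eq_integral_mellinWk, fourier_real_eq_integral_exp_smul,
    ← integral_const_mul ((x ^ (-(5 / 4) : ℝ) : ℝ) : ℂ)]
  congr 1
  refine integral_congr_ae (Eventually.of_forall fun t => ?_)
  beta_reduce
  have hx' : (x : ℂ) ≠ 0 := Complex.ofReal_ne_zero.2 hx.ne'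
  rw [neg_add, Complex.cpow_add _ _ hx', Complex.ofReal_cpow hx.le, Complex.ofReal_neg,
    Complex.cpow_def_of_ne_zero hx' (-(t * Complex.I)), ← Complex.ofReal_log hx.le, smul_eq_mul,
    show -2 * π * t * (log x / (2 * π)) = -(t * log x) by field_simp]
  push_cast
  rw [show (log x : ℂ) * -(t * Complex.I) = -(t * log x) * Complex.I by ring]
  ring

lemma contDiffOn_Wk (k : ℕ) : ContDiffOn ℝ (⊤ : ℕ∞) (Wk k) (Set.Ioi (0 : ℝ)) := by
  obtain ⟨C, hC⟩ := exists_norm_mellinWk_le k (5 / 4)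
  have hF : ContDiff ℝ (⊤ : ℕ∞) (FourierTransform.fourier
      (fun t : ℝ => mellinWk k ((5 / 4 : ℝ) + t * Complex.I))) := by
    refine contDiff_fourier fun n _ => ?_
    have hcont := continuous_mellinWk_vertical k (σ := 5 / 4) le_rfl
    refine ((integrable_abs_pow_mul_exp_neg_mul_abs n (c := π / 5) (by positivity)).const_mul
      C).mono' (by fun_prop) (Eventually.of_forall fun t => ?_)
    have h := hC ((5 / 4 : ℝ) + t * Complex.I) (by simp) (by simp)
    rw [norm_of_nonneg (by positivity), norm_eq_abs, mul_left_comm]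
    gcongr
    simpa using h
  have hlog : ContDiffOn ℝ (⊤ : ℕ∞) (fun x : ℝ => log x / (2 * π)) (Set.Ioi 0) := fun x hx =>
    ((contDiffAt_log.2 (ne_of_gt hx)).div_const _).contDiffWithinAt
  have hpow : ContDiffOn ℝ (⊤ : ℕ∞) (fun x : ℝ => ((x ^ (-(5 / 4) : ℝ) : ℝ) : ℂ)) (Set.Ioi 0) :=
    Complex.ofRealCLM.contDiff.comp_contDiffOn fun x hx =>
      (contDiffAt_rpow_const_of_ne (ne_of_gt hx)).contDiffWithinAt
  exact (contDiffOn_const.mul (hpow.mul (hF.comp_contDiffOn hlog))).congr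
    fun x hx => Wk_eq_fourier k hx

lemma exists_norm_Wk_le (k : ℕ) {b : ℝ} (hb : 5 / 4 ≤ b) :
    ∃ C > (0 : ℝ), ∀ x : ℝ, 1 ≤ x → ‖Wk k x‖ ≤ C * x ^ (-b) := by
  obtain ⟨C, hC⟩ := exists_norm_mellinWk_le k b
  have hexp : Integrable fun t : ℝ => C * rexp (-(π / 5 * |t|)) := by
    simpa using (integrable_abs_pow_mul_exp_neg_mul_abs 0 (c := π / 5) (by positivity)).const_mul C
  set J := ∫ t : ℝ, C * rexp (-(π / 5 * |t|)) with hJ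
  refine ⟨1 / (2 * π) * |J| + 1, by positivity, fun x hx => ?_⟩
  have hx0 : 0 < x := one_pos.trans_le hx
  have hx' : (x : ℂ) ≠ 0 := Complex.ofReal_ne_zero.2 hx0.ne'
  have hshift := integral_vertical_eq_of_exp_decay (f := fun s => mellinWk k s * (x : ℂ) ^ (-s))
    (C := C) hb (c := π / 5) (by positivity)
    (fun s h1 _ => (differentiableAt_mellinWk k h1).mul
      (differentiableAt_id.neg.const_cpow (Or.inl hx')))
    (fun s h1 h2 => by
      have h := hC s h1 h2
      rw [norm_mul, Complex.norm_cpow_eq_rpow_re_of_pos hx0, Complex.neg_re]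
      exact (mul_le_of_le_one_right (norm_nonneg _)
        (rpow_le_one_of_one_le_of_nonpos hx (by linarith))).trans h)
  have hI : ‖∫ t : ℝ, mellinWk k (b + t * Complex.I) * (x : ℂ) ^ (-(b + t * Complex.I))‖ ≤
      J * x ^ (-b) := by
    rw [hJ, ← integral_mul_const]
    refine norm_integral_le_of_norm_le (hexp.mul_const _) (Eventually.of_forall fun t => ?_)
    have h := hC (b + t * Complex.I) (by simpa using hb) (by simp)
    rw [norm_mul, Complex.norm_cpow_eq_rpow_re_of_pos hx0]
    simp only [Complex.neg_re, Complex.add_re, Complex.ofReal_re, Complex.re_ofReal_mul,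
      Complex.I_re, mul_zero, add_zero]
    gcongr
    simpa using h
  have hxb : 0 < x ^ (-b) := rpow_pos_of_pos hx0 _
  have hπ : ‖(1 / (2 * π) : ℂ)‖ = 1 / (2 * π) := by
    simp [abs_of_pos pi_pos]
  rw [Wk_eq_integral_mellinWk, hshift, norm_mul, hπ]
  calc _ ≤ 1 / (2 * π) * (|J| * x ^ (-b)) := by
        gcongr
        exact hI.trans (by gcongr; exact le_abs_self J)
    _ ≤ _ := by nlinarith

/-- `W_k` is real-valued and infinitely differentiable on `(0,∞)`,
and for every positive integer `N` one has `|W_k(x)| ≤ C x^(-N)` for `x ≥ 1`. -/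
theorem Wk_properties (k : ℕ) (hk : 2 ≤ k) :
    (∀ x : ℝ, 0 < x → (Wk k x).im = 0) ∧
    ContDiffOn ℝ (⊤ : ℕ∞) (Wk k) (Set.Ioi (0 : ℝ)) ∧
    (∀ N : ℕ, 0 < N → ∃ C > (0:ℝ), ∀ x : ℝ, 1 ≤ x →
      ‖Wk k x‖ ≤ C * x ^ (-(N : ℝ))) := by
  refine ⟨fun x hx => Wk_im hx, contDiffOn_Wk k, fun N _ => ?_⟩
  obtain ⟨C, hC, h⟩ := exists_norm_Wk_le k (b := N + 2) (by linarith [N.cast_nonneg (α := ℝ)])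
  refine ⟨C, hC, fun x hx => (h x hx).trans ?_⟩
  gcongr
  linarith
end
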